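/- Let F be an algebraically closed field of characteristic 0, K/F a field extension with K algebraically closed, A a finite-dimensional nonassociative F-algebra, G an abelian group, and Γ : A = ⊕_{g∈G} A_g a G-grading on A. Then Γ is fine if and only if the extended grading Γ_K on A_K = A ⊗_F K is fine. -/

import Mathlib

open scoped TensorProduct

universe u

section GradingDefs

variable {F : Type*} [Field F] {A : Type*} [NonUnitalNonAssocSemiring A] [Module F A]

/-- The family `comp` of `F`-subspaces is a grading of the nonassociative `F`-algebra `A`
by the abelian group `G`: `A` is the (internal) direct sum of the subspaces `comp g`, and
`comp g * comp h ⊆ comp (g * h)`. -/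
def IsGrading {G : Type*} [CommGroup G] (comp : G → Submodule F A) : Prop :=
  iSupIndep comp ∧ (⨆ g, comp g) = ⊤ ∧
    ∀ (g h : G) (a b : A), a ∈ comp g → b ∈ comp h → a * b ∈ comp (g * h)

/-- The support of a grading: those degrees with nonzero homogeneous component. -/
def gradingSupp {G : Type*} [CommGroup G] (comp : G → Submodule F A) : Set G :=
  {g | comp g ≠ ⊥}

/-- A linear automorphism of `A` is an algebra automorphism if it preserves multiplication. -/
def IsAlgAut (φ : A ≃ₗ[F] A) : Prop := ∀ a b : A, φ (a * b) = φ a * φ b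

/-- Two `G`-gradings are isomorphic if some algebra automorphism maps each homogeneous
component of the first onto the component of the same degree of the second. -/
def GradingIso {G : Type*} [CommGroup G] (comp comp' : G → Submodule F A) : Prop :=
  ∃ φ : A ≃ₗ[F] A, IsAlgAut φ ∧
    ∀ g, (comp g).map (φ : A →ₗ[F] A) = comp' g

/-- A `G`-grading and an `H`-grading are equivalent if there are a bijection `α` between the
supports and an algebra automorphism `φ` with `φ (comp g) = comp' (α g)` on the support. -/
def GradingEquiv {G : Type*} [CommGroup G] {H : Type*} [CommGroup H]
    (comp : G → Submodule F A) (comp' : H → Submodule F A) : Prop :=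
  ∃ (α : G → H) (φ : A ≃ₗ[F] A), IsAlgAut φ ∧
    Set.BijOn α (gradingSupp comp) (gradingSupp comp') ∧
    ∀ g ∈ gradingSupp comp, (comp g).map (φ : A →ₗ[F] A) = comp' (α g)

/-- An `H`-indexed family `comp'` refines a `G`-indexed family `comp` if every nonzero
component of `comp'` is contained in some nonzero component of `comp`. -/
def IsRefinement {H : Type*} [CommGroup H] {G : Type*} [CommGroup G]
    (comp' : H → Submodule F A) (comp : G → Submodule F A) : Prop :=
  ∀ h ∈ gradingSupp comp', ∃ g ∈ gradingSupp comp, comp' h ≤ comp g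

/-- A refinement is proper if some containment of a nonzero component of the refinement in a
component of the coarser grading is strict. -/
def IsProperRefinement {H : Type*} [CommGroup H] {G : Type*} [CommGroup G]
    (comp' : H → Submodule F A) (comp : G → Submodule F A) : Prop :=
  IsRefinement comp' comp ∧
    ∃ h ∈ gradingSupp comp', ∃ g ∈ gradingSupp comp, comp' h < comp g

/-- A grading is fine if it admits no proper refinement which is itself a grading by an
abelian group. -/
def IsFine {G : Type*} [CommGroup G] (comp : G → Submodule F A) : Prop :=
  ∀ (H : Type u) (_ : CommGroup H) (comp' : H → Submodule F A),
    IsGrading comp' → ¬ IsProperRefinement comp' comp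

end GradingDefs

/-- A family of linear projections onto the components of a grading with finite support. -/
structure IsGradingProj {R A G : Type*} [Semiring R] [NonUnitalNonAssocRing A] [Module R A]
    [CommGroup G] (P : G → Module.End R A) : Prop where
  idem : ∀ g x, P g (P g x) = P g x
  ortho : ∀ g h, g ≠ h → ∀ x, P g (P h x) = 0
  exists_sum : ∃ T : Finset G, (∀ g ∉ T, P g = 0) ∧ ∀ x, ∑ g ∈ T, P g x = x
  mul : ∀ g h x y, P (g * h) (P g x * P h y) = P g x * P h y

namespace IsGradingProj

section Transfer

variable {R S A B G : Type*} [Semiring R] [NonUnitalNonAssocRing A] [Module R A]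
  [Semiring S] [NonUnitalNonAssocRing B] [Module S B] [CommGroup G]
  {P : G → Module.End R A} {Q : G → Module.End S B}

theorem of_injective (hP : IsGradingProj P) (i : B →ₙ+* A) (hi : Function.Injective i)
    (h : ∀ g x, i (Q g x) = P g (i x)) : IsGradingProj Q where
  idem g x := hi (by rw [h, h, hP.idem])
  ortho g k hgk x := hi (by rw [h, h, hP.ortho g k hgk, map_zero])
  exists_sum := by
    obtain ⟨T, hT, hs⟩ := hP.exists_sum
    refine ⟨T, fun g hg => ?_, fun x => hi ?_⟩
    · ext x
      apply hi
      rw [h, hT g hg, LinearMap.zero_apply, LinearMap.zero_apply, map_zero]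
    · rw [map_sum]
      simp only [h, hs]
  mul g k x y := hi (by rw [h, map_mul, h, h, hP.mul])

theorem of_surjective (hP : IsGradingProj P) (s : A →ₙ+* B) (hs : Function.Surjective s)
    (h : ∀ g x, s (P g x) = Q g (s x)) : IsGradingProj Q where
  idem g y := by
    obtain ⟨x, rfl⟩ := hs y
    rw [← h, ← h, hP.idem]
  ortho g k hgk y := by
    obtain ⟨x, rfl⟩ := hs y
    rw [← h, ← h, hP.ortho g k hgk, map_zero]
  exists_sum := by
    obtain ⟨T, hT, hsum⟩ := hP.exists_sum
    refine ⟨T, fun g hg => ?_, fun y => ?_⟩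
    · ext y
      obtain ⟨x, rfl⟩ := hs y
      rw [← h, hT g hg, LinearMap.zero_apply, LinearMap.zero_apply, map_zero]
    · obtain ⟨x, rfl⟩ := hs y
      simp only [← h]
      rw [← map_sum, hsum]
  mul g k x y := by
    obtain ⟨x, rfl⟩ := hs x
    obtain ⟨y, rfl⟩ := hs y
    rw [← h, ← h, ← map_mul, ← h, hP.mul]

end Transfer

theorem isGrading {F A G : Type*} [Field F] [NonUnitalNonAssocRing A] [Module F A]
    [CommGroup G] {P : G → Module.End F A} (hP : IsGradingProj P) :
    IsGrading fun g => LinearMap.range (P g) := by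
  refine ⟨fun g => ?_, ?_, ?_⟩
  · rw [Submodule.disjoint_def]
    rintro _ ⟨x, rfl⟩ hx
    have hle : (⨆ (k : G) (_ : k ≠ g), LinearMap.range (P k)) ≤ LinearMap.ker (P g) := by
      refine iSup₂_le fun k hk => ?_
      rintro _ ⟨y, rfl⟩
      exact hP.ortho g k hk.symm y
    have := hle hx
    rwa [LinearMap.mem_ker, hP.idem] at this
  · obtain ⟨T, -, hs⟩ := hP.exists_sum
    refine eq_top_iff.2 fun x _ => ?_
    rw [← hs x]
    exact Submodule.sum_mem _ fun g _ =>
      (le_iSup (fun g => LinearMap.range (P g)) g) (LinearMap.mem_range_self _ _)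
  · rintro g h _ _ ⟨x, rfl⟩ ⟨y, rfl⟩
    exact ⟨_, hP.mul g h x y⟩

theorem isProj {F A G : Type*} [Field F] [NonUnitalNonAssocRing A] [Module F A]
    [CommGroup G] {P : G → Module.End F A} (hP : IsGradingProj P) (g : G) :
    LinearMap.IsProj (LinearMap.range (P g)) (P g) where
  map_mem x := LinearMap.mem_range_self _ x
  map_id := by
    rintro _ ⟨x, rfl⟩
    exact hP.idem g x

theorem trace {F A G : Type*} [Field F] [NonUnitalNonAssocRing A] [Module F A]
    [FiniteDimensional F A] [CommGroup G] {P : G → Module.End F A}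
    (hP : IsGradingProj P) (g : G) :
    LinearMap.trace F A (P g) = Module.finrank F (LinearMap.range (P g)) :=
  (hP.isProj g).trace

/-- The base change of a family of grading projections. -/
theorem baseChange {F K A G : Type*} [Field F] [Field K] [Algebra F K]
    [NonUnitalNonAssocRing A] [Module F A] [SMulCommClass F A A] [IsScalarTower F A A]
    [CommGroup G] {P : G → Module.End F A} (hP : IsGradingProj P) :
    IsGradingProj fun g => (P g).baseChange K where
  idem g x := by
    induction x with
    | zero => simp
    | add x y hx hy => simp only [map_add, hx, hy]
    | tmul c a => simp [hP.idem]
  ortho g k hgk x := by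
    induction x with
    | zero => simp
    | add x y hx hy => simp only [map_add, hx, hy, add_zero]
    | tmul c a => simp [hP.ortho g k hgk]
  exists_sum := by
    obtain ⟨T, hT, hs⟩ := hP.exists_sum
    refine ⟨T, fun g hg => by rw [hT g hg, LinearMap.baseChange_zero], fun x => ?_⟩
    induction x with
    | zero => simp
    | add x y hx hy => simp only [map_add, Finset.sum_add_distrib, hx, hy]
    | tmul c a => simp only [LinearMap.baseChange_tmul, ← TensorProduct.tmul_sum, hs]
  mul g k x y := by
    induction x with
    | zero => simp
    | add x x' hx hx' => simp only [map_add, add_mul, hx, hx']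
    | tmul c a =>
      induction y with
      | zero => simp
      | add y y' hy hy' => simp only [map_add, mul_add, hy, hy']
      | tmul d b => simp [Algebra.TensorProduct.tmul_mul_tmul, hP.mul]

end IsGradingProj

theorem IsGrading.exists_isGradingProj {F A G : Type*} [Field F] [NonUnitalNonAssocRing A]
    [Module F A] [FiniteDimensional F A] [CommGroup G] {comp : G → Submodule F A}
    (hcomp : IsGrading comp) :
    ∃ P : G → Module.End F A, IsGradingProj P ∧ ∀ g, LinearMap.range (P g) = comp g := by
  classical
  obtain ⟨hind, htop, hmul⟩ := hcomp
  have hinternal : DirectSum.IsInternal comp :=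
    (DirectSum.isInternal_submodule_iff_iSupIndep_and_iSup_eq_top comp).2 ⟨hind, htop⟩
  let _ := hinternal.chooseDecomposition
  let P : G → Module.End F A := fun g =>
    (comp g).subtype ∘ₗ DirectSum.component F G (fun g => comp g) g ∘ₗ
      (DirectSum.decomposeLinearEquiv comp).toLinearMap
  have hPdef : ∀ g x, P g x = (DirectSum.decompose comp x g : A) := fun g x => rfl
  have hmem : ∀ g x, P g x ∈ comp g := fun g x => by rw [hPdef]; exact SetLike.coe_mem _
  have hsame : ∀ g, ∀ x ∈ comp g, P g x = x := fun g x hx =>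
    DirectSum.decompose_of_mem_same comp hx
  have hfin : {g | comp g ≠ ⊥}.Finite := WellFoundedGT.finite_ne_bot_of_iSupIndep hind
  have hzero : ∀ g ∉ hfin.toFinset, P g = 0 := fun g hg => by
    ext x
    have := hmem g x
    simp only [Set.Finite.mem_toFinset, Set.mem_ofPred_eq, not_not] at hg
    rwa [hg, Submodule.mem_bot] at this
  refine ⟨P, ⟨fun g x => hsame g _ (hmem g x), fun g k hgk x =>
    DirectSum.decompose_of_mem_ne comp (hmem k x) hgk.symm, ⟨hfin.toFinset, hzero, fun x => ?_⟩,
    fun g k x y => hsame _ _ (hmul g k _ _ (hmem g x) (hmem k y))⟩, fun g => le_antisymm ?_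
      fun x hx => ⟨x, hsame g x hx⟩⟩
  · conv_rhs => rw [← DirectSum.sum_support_decompose comp x]
    symm
    refine Finset.sum_subset (fun g hg => ?_) fun g _ hg => ?_
    · by_contra hg'
      rw [DFinsupp.mem_support_iff] at hg
      apply hg
      ext
      rw [← hPdef, hzero g hg']
      rfl
    · rw [DFinsupp.notMem_support_iff] at hg
      rw [hg]
      rfl
  · rintro _ ⟨x, rfl⟩
    exact hmem g x

theorem LinearMap.range_baseChange_eq {F K V W : Type*} [Field F] [Field K] [Algebra F K]
    [AddCommGroup V] [Module F V] [AddCommGroup W] [Module F W] (f : V →ₗ[F] W) :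
    LinearMap.range (f.baseChange K) = (LinearMap.range f).baseChange K := by
  apply le_antisymm
  · rintro _ ⟨x, rfl⟩
    induction x with
    | zero => simp
    | add x y hx hy => rw [map_add]; exact add_mem hx hy
    | tmul c a =>
      rw [LinearMap.baseChange_tmul]
      exact Submodule.tmul_mem_baseChange_of_mem _ (LinearMap.mem_range_self _ _)
  · rw [Submodule.baseChange_eq_span, Submodule.span_le]
    rintro _ ⟨_, ⟨x, rfl⟩, rfl⟩
    exact ⟨1 ⊗ₜ x, by simp⟩

theorem Submodule.finrank_baseChange_eq {F K V : Type*} [Field F] [Field K] [Algebra F K]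
    [AddCommGroup V] [Module F V] (p : Submodule F V) :
    Module.finrank K (p.baseChange K) = Module.finrank F p := by
  have hinj : Function.Injective (p.toBaseChange K) := by
    have h : Function.Injective (p.subtype.baseChange K) := by
      rw [LinearMap.baseChange_eq_ltensor]
      exact Module.Flat.lTensor_preserves_injective_linearMap _ p.injective_subtype
    exact fun x y hxy => h (congrArg Subtype.val hxy)
  rw [← (LinearEquiv.ofBijective _ ⟨hinj, p.toBaseChange_surjective K⟩).finrank_eq,
    Module.finrank_baseChange]

/-- A nontrivial finitely generated algebra over an algebraically closed field has a rational
point. -/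
theorem exists_algHom_of_finiteType (F R : Type*) [Field F] [IsAlgClosed F] [CommRing R]
    [Nontrivial R] [Algebra F R] [Algebra.FiniteType F R] : Nonempty (R →ₐ[F] F) := by
  obtain ⟨m, hm⟩ := Ideal.exists_maximal R
  let _ : Field (R ⧸ m) := Ideal.Quotient.field m
  have : Algebra.FiniteType F (R ⧸ m) :=
    Algebra.FiniteType.of_surjective (Ideal.Quotient.mkₐ F m) (Ideal.Quotient.mkₐ_surjective F m)
  have : Module.Finite F (R ⧸ m) := finite_of_finite_type_of_isJacobsonRing F (R ⧸ m)
  let τ : (R ⧸ m) →ₐ[F] F := IsAlgClosed.lift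
  exact ⟨τ.comp (Ideal.Quotient.mkₐ F m)⟩

section ChangeOfRings

variable {F R S A : Type*} [Field F] [CommRing R] [Algebra F R] [CommRing S] [Algebra F S]
  [NonUnitalNonAssocRing A] [Module F A] [SMulCommClass F A A] [IsScalarTower F A A]

/-- The ring homomorphism `R ⊗ A → S ⊗ A` induced by a homomorphism `R → S`. -/
noncomputable def AlgHom.tensorMap (A : Type*) [NonUnitalNonAssocRing A] [Module F A]
    [SMulCommClass F A A] [IsScalarTower F A A] (φ : R →ₐ[F] S) :
    (R ⊗[F] A) →ₙ+* (S ⊗[F] A) where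
  toFun := LinearMap.rTensor A φ.toLinearMap
  map_zero' := map_zero _
  map_add' := map_add _
  map_mul' x y := by
    induction x with
    | zero => simp
    | add x x' hx hx' => simp only [map_add, add_mul, hx, hx']
    | tmul c a =>
      induction y with
      | zero => simp
      | add y y' hy hy' => simp only [map_add, mul_add, hy, hy']
      | tmul d b => simp [Algebra.TensorProduct.tmul_mul_tmul]

theorem AlgHom.tensorMap_apply (φ : R →ₐ[F] S) (x : R ⊗[F] A) :
    φ.tensorMap A x = LinearMap.rTensor A φ.toLinearMap x := rfl

@[simp]
theorem AlgHom.tensorMap_tmul (φ : R →ₐ[F] S) (r : R) (a : A) :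
    φ.tensorMap A (r ⊗ₜ[F] a) = φ r ⊗ₜ a := rfl

theorem AlgHom.tensorMap_smul (φ : R →ₐ[F] S) (r : R) (x : R ⊗[F] A) :
    φ.tensorMap A (r • x) = φ r • φ.tensorMap A x := by
  induction x with
  | zero => simp
  | add x y hx hy => simp only [smul_add, map_add, hx, hy]
  | tmul c a => simp [TensorProduct.smul_tmul']

theorem AlgHom.tensorMap_injective (φ : R →ₐ[F] S) (hφ : Function.Injective φ) :
    Function.Injective (φ.tensorMap A) :=
  Module.Flat.rTensor_preserves_injective_linearMap φ.toLinearMap hφ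

theorem AlgHom.tensorMap_surjective (φ : R →ₐ[F] S) (hφ : Function.Surjective φ) :
    Function.Surjective (φ.tensorMap A) :=
  LinearMap.rTensor_surjective A hφ

theorem AlgHom.baseChange_tensorMap (φ : R →ₐ[F] S) (p : Module.End F A) (x : R ⊗[F] A) :
    p.baseChange S (φ.tensorMap A x) = φ.tensorMap A (p.baseChange R x) := by
  induction x with
  | zero => simp
  | add x y hx hy => simp only [map_add, hx, hy]
  | tmul c a => simp

theorem AlgHom.liftBaseChange_tensorMap (φ : R →ₐ[F] S) (f : A →ₗ[F] R ⊗[F] A)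
    (g : A →ₗ[F] S ⊗[F] A) (h : ∀ a, φ.tensorMap A (f a) = g a) (x : R ⊗[F] A) :
    φ.tensorMap A (f.liftBaseChange R x) = g.liftBaseChange S (φ.tensorMap A x) := by
  induction x with
  | zero => simp
  | add x y hx hy => simp only [map_add, hx, hy]
  | tmul c a => simp [AlgHom.tensorMap_smul, h]

theorem AlgHom.repr_tensorMap {ι : Type*} (b : Module.Basis ι F A) (φ : R →ₐ[F] S)
    (x : R ⊗[F] A) (k : ι) :
    (b.baseChange S).repr (φ.tensorMap A x) k = φ ((b.baseChange R).repr x k) := by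
  induction x with
  | zero => simp
  | add x y hx hy => simp only [map_add, Finsupp.add_apply, hx, hy]
  | tmul c a => simp [Module.Basis.baseChange_repr_tmul]

theorem AlgHom.trace_tensorMap [FiniteDimensional F A] (φ : R →ₐ[F] S)
    (p : Module.End R (R ⊗[F] A)) (q : Module.End S (S ⊗[F] A))
    (h : ∀ x, φ.tensorMap A (p x) = q (φ.tensorMap A x)) :
    LinearMap.trace S _ q = φ (LinearMap.trace R _ p) := by
  classical
  let b := Module.finBasis F A
  rw [LinearMap.trace_eq_matrix_trace S (b.baseChange S),
    LinearMap.trace_eq_matrix_trace R (b.baseChange R), Matrix.trace, Matrix.trace, map_sum]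
  refine Finset.sum_congr rfl fun k _ => ?_
  rw [Matrix.diag_apply, Matrix.diag_apply, LinearMap.toMatrix_apply, LinearMap.toMatrix_apply,
    ← φ.repr_tensorMap, h]
  simp [Module.Basis.baseChange_apply]

variable (F A) in
/-- The canonical isomorphism `F ⊗ A → A` as a ring homomorphism. -/
noncomputable def tensorLidHom : (F ⊗[F] A) →ₙ+* A where
  toFun := TensorProduct.lid F A
  map_zero' := map_zero _
  map_add' := map_add _
  map_mul' x y := by
    induction x with
    | zero => simp
    | add x x' hx hx' => simp only [map_add, add_mul, hx, hx']
    | tmul c a =>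
      induction y with
      | zero => simp
      | add y y' hy hy' => simp only [map_add, mul_add, hy, hy']
      | tmul d b => simp [Algebra.TensorProduct.tmul_mul_tmul, smul_mul_smul_comm]

end ChangeOfRings

/-- Finitely many endomorphisms of `K ⊗ A` are defined over a finitely generated subalgebra. -/
theorem exists_fg_subalgebra_descent {F K A H : Type*} [Field F] [Field K] [Algebra F K]
    [NonUnitalNonAssocRing A] [Module F A] [SMulCommClass F A A] [IsScalarTower F A A]
    [FiniteDimensional F A] (P : H → Module.End K (K ⊗[F] A)) (T : Finset H)
    (hT : ∀ h ∉ T, P h = 0) :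
    ∃ (R : Subalgebra F K) (f : H → A →ₗ[F] R ⊗[F] A), R.FG ∧
      ∀ h x, R.val.tensorMap A ((f h).liftBaseChange R x) = P h (R.val.tensorMap A x) := by
  classical
  let b := Module.finBasis F A
  let c : H → Fin (Module.finrank F A) → Fin (Module.finrank F A) → K := fun h j k =>
    (b.baseChange K).repr (P h (1 ⊗ₜ b j)) k
  let s : Finset K := insert 0 ((T ×ˢ Finset.univ).image
    fun x : H × Fin (Module.finrank F A) × Fin (Module.finrank F A) => c x.1 x.2.1 x.2.2)
  have hs : ∀ h j k, c h j k ∈ s := by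
    intro h j k
    by_cases hh : h ∈ T
    · exact Finset.mem_insert_of_mem (Finset.mem_image.2
        ⟨(h, j, k), Finset.mem_product.2 ⟨hh, Finset.mem_univ _⟩, rfl⟩)
    · have : c h j k = 0 := by simp [c, hT h hh]
      rw [this]
      exact Finset.mem_insert_self _ _
  let R : Subalgebra F K := Algebra.adjoin F (s : Set K)
  let f : H → A →ₗ[F] R ⊗[F] A := fun h => b.constr F fun j =>
    ∑ k, (⟨c h j k, Algebra.subset_adjoin (hs h j k)⟩ : R) ⊗ₜ[F] b k
  refine ⟨R, f, ⟨s, rfl⟩, fun h x => ?_⟩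
  let g : A →ₗ[F] K ⊗[F] A := (P h).restrictScalars F ∘ₗ TensorProduct.mk F K A 1
  have hg : g.liftBaseChange K = P h := by
    ext a
    simp [g]
  have hfg : LinearMap.rTensor A R.val.toLinearMap ∘ₗ f h = g := by
    refine b.ext fun j => ?_
    have hsum := (b.baseChange K).sum_repr (P h (1 ⊗ₜ b j))
    simp only [Module.Basis.baseChange_apply, TensorProduct.smul_tmul', smul_eq_mul,
      mul_one] at hsum
    simp only [LinearMap.comp_apply, f, Module.Basis.constr_basis, map_sum, g,
      LinearMap.rTensor_tmul]
    exact hsum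
  rw [AlgHom.liftBaseChange_tensorMap R.val (f h) g (fun a => LinearMap.congr_fun hfg a), hg]

/-- A proper refinement of the extended grading specializes to one of the original grading. -/
theorem exists_isProperRefinement_of_baseChange {F K A G H : Type*} [Field F] [IsAlgClosed F]
    [CharZero F] [Field K] [Algebra F K] [NonUnitalNonAssocRing A] [Module F A]
    [SMulCommClass F A A] [IsScalarTower F A A] [FiniteDimensional F A] [CommGroup G]
    [CommGroup H] {comp : G → Submodule F A} (hcomp : IsGrading comp)
    {comp' : H → Submodule K (K ⊗[F] A)} (hcomp' : IsGrading comp')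
    (href : IsProperRefinement comp' fun g => (comp g).baseChange K) :
    ∃ comp'' : H → Submodule F A, IsGrading comp'' ∧ IsProperRefinement comp'' comp := by
  have : CharZero K := charZero_of_injective_algebraMap (algebraMap F K).injective
  obtain ⟨p, hp, hpr⟩ := hcomp.exists_isGradingProj
  obtain ⟨P, hP, hPr⟩ := hcomp'.exists_isGradingProj
  obtain ⟨T, hT, -⟩ := hP.exists_sum
  obtain ⟨R, f, hR, hf⟩ := exists_fg_subalgebra_descent P T hT
  have : Algebra.FiniteType F R := R.fg_iff_finiteType.1 hR
  obtain ⟨σ⟩ := exists_algHom_of_finiteType F R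
  have hσ : Function.Surjective σ := fun c => ⟨algebraMap F R c, by simp⟩
  have hval : Function.Injective (R.val.tensorMap A) :=
    R.val.tensorMap_injective Subtype.val_injective
  let g : H → A →ₗ[F] F ⊗[F] A := fun h => LinearMap.rTensor A σ.toLinearMap ∘ₗ f h
  have hg : ∀ h x, σ.tensorMap A ((f h).liftBaseChange R x) =
      (g h).liftBaseChange F (σ.tensorMap A x) := fun h =>
    σ.liftBaseChange_tensorMap (f h) (g h) fun a => rfl
  let Q : H → Module.End F A := fun h =>
    (TensorProduct.lid F A).conj ((g h).liftBaseChange F)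
  have hQ : ∀ h x, tensorLidHom F A ((g h).liftBaseChange F x) = Q h (tensorLidHom F A x) := by
    intro h x
    change TensorProduct.lid F A _ = (TensorProduct.lid F A).conj _ (TensorProduct.lid F A x)
    rw [LinearEquiv.conj_apply_apply, LinearEquiv.symm_apply_apply]
  have hQproj : IsGradingProj Q :=
    ((hP.of_injective (R.val.tensorMap A) hval hf).of_surjective (σ.tensorMap A)
      (σ.tensorMap_surjective hσ) hg).of_surjective (tensorLidHom F A)
      (TensorProduct.lid F A).surjective hQ
  have hrank : ∀ h, Module.finrank F (LinearMap.range (Q h)) = Module.finrank K (comp' h) := by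
    intro h
    have h₁ := hQproj.trace h
    have h₂ := hP.trace h
    rw [LinearMap.trace_conj', σ.trace_tensorMap _ _ (hg h)] at h₁
    rw [R.val.trace_tensorMap _ _ (hf h), hPr] at h₂
    have h₃ : LinearMap.trace R _ ((f h).liftBaseChange R) = (Module.finrank K (comp' h) : R) :=
      Subtype.val_injective (by simpa using h₂)
    rw [h₃, map_natCast] at h₁
    exact_mod_cast h₁.symm
  have hle : ∀ h k, comp' h ≤ (comp k).baseChange K → LinearMap.range (Q h) ≤ comp k := by
    rintro h k hhk _ ⟨a, rfl⟩
    obtain ⟨y, rfl⟩ := (TensorProduct.lid F A).surjective a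
    obtain ⟨x, rfl⟩ := σ.tensorMap_surjective (A := A) hσ y
    have hx : (p k).baseChange R ((f h).liftBaseChange R x) = (f h).liftBaseChange R x := by
      apply hval
      rw [← AlgHom.baseChange_tensorMap, hf]
      have hmem : P h (R.val.tensorMap A x) ∈ LinearMap.range ((p k).baseChange K) := by
        rw [LinearMap.range_baseChange_eq, hpr]
        exact hhk (hPr h ▸ LinearMap.mem_range_self _ _)
      obtain ⟨z, hz⟩ := hmem
      rw [← hz]
      exact hp.baseChange.idem k z
    rw [← hpr]
    refine ⟨Q h (TensorProduct.lid F A (σ.tensorMap A x)), ?_⟩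
    have hlid : ∀ z : F ⊗[F] A,
        p k (TensorProduct.lid F A z) = TensorProduct.lid F A ((p k).baseChange F z) := by
      intro z
      induction z with
      | zero => simp
      | add z w hz hw => simp only [map_add, hz, hw]
      | tmul c a => simp
    have hQ' : Q h (TensorProduct.lid F A (σ.tensorMap A x)) =
        TensorProduct.lid F A (σ.tensorMap A ((f h).liftBaseChange R x)) := by
      rw [hg]
      exact (hQ h _).symm
    rw [hQ', hlid, AlgHom.baseChange_tensorMap, hx]
  have hsupp : ∀ h, LinearMap.range (Q h) ≠ ⊥ ↔ comp' h ≠ ⊥ := fun h => by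
    rw [ne_eq, ne_eq, ← Submodule.finrank_eq_zero (R := F), hrank, Submodule.finrank_eq_zero]
  have hsupp' : ∀ k, (comp k).baseChange K ≠ ⊥ → comp k ≠ ⊥ := fun k hk h0 =>
    hk (by rw [h0, Submodule.baseChange_bot])
  obtain ⟨href, h, hh, k, hk, hlt⟩ := href
  refine ⟨_, hQproj.isGrading, fun h hh => ?_, h, (hsupp h).2 hh, k, hsupp' k hk,
    lt_of_le_of_ne (hle h k hlt.le) fun heq => ?_⟩
  · obtain ⟨k, hk, hhk⟩ := href h ((hsupp h).1 hh)
    exact ⟨k, hsupp' k hk, hle h k hhk⟩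
  · have := Submodule.finrank_lt_finrank_of_lt hlt
    rw [Submodule.finrank_baseChange_eq, ← hrank] at this
    exact this.ne (congrArg (fun p : Submodule F A => Module.finrank F p) heq)

theorem IsGrading.baseChange {F K A G : Type*} [Field F] [Field K] [Algebra F K]
    [NonUnitalNonAssocRing A] [Module F A] [SMulCommClass F A A] [IsScalarTower F A A]
    [FiniteDimensional F A] [CommGroup G] {comp : G → Submodule F A} (hcomp : IsGrading comp) :
    IsGrading fun g => (comp g).baseChange K := by
  obtain ⟨P, hP, hPr⟩ := hcomp.exists_isGradingProj
  simpa only [LinearMap.range_baseChange_eq, hPr] using (hP.baseChange (K := K)).isGrading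

theorem IsProperRefinement.baseChange {F K A G H : Type*} [Field F] [Field K] [Algebra F K]
    [NonUnitalNonAssocRing A] [Module F A] [SMulCommClass F A A] [IsScalarTower F A A]
    [FiniteDimensional F A] [CommGroup G] [CommGroup H] {comp : G → Submodule F A}
    {comp' : H → Submodule F A} (href : IsProperRefinement comp' comp) :
    IsProperRefinement (fun h => (comp' h).baseChange K) fun g => (comp g).baseChange K := by
  have hsupp : ∀ p : Submodule F A, p.baseChange K ≠ ⊥ ↔ p ≠ ⊥ := fun p => by
    rw [ne_eq, ne_eq, ← Submodule.finrank_eq_zero (R := K), Submodule.finrank_baseChange_eq,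
      Submodule.finrank_eq_zero]
  obtain ⟨href, h, hh, k, hk, hlt⟩ := href
  refine ⟨fun h hh => ?_, h, (hsupp _).2 hh, k, (hsupp _).2 hk,
    lt_of_le_of_ne (Submodule.baseChange_mono _ hlt.le) fun heq => ?_⟩
  · obtain ⟨k, hk, hhk⟩ := href h ((hsupp _).1 hh)
    exact ⟨k, (hsupp _).2 hk, Submodule.baseChange_mono _ hhk⟩
  · have := Submodule.finrank_lt_finrank_of_lt hlt
    rw [← Submodule.finrank_baseChange_eq (K := K),
      ← Submodule.finrank_baseChange_eq (K := K) (comp k)] at this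
    exact this.ne (congrArg (fun p : Submodule K (K ⊗[F] A) => Module.finrank K p) heq)

/-- `Γ` is fine iff `Γ_K` is fine. -/
theorem isFine_iff_baseChange
    {F : Type*} [Field F] [IsAlgClosed F] [CharZero F]
    {K : Type*} [Field K] [Algebra F K] [IsAlgClosed K]
    {A : Type*} [NonUnitalNonAssocRing A] [Module F A]
    [SMulCommClass F A A] [IsScalarTower F A A] [FiniteDimensional F A]
    {G : Type*} [CommGroup G] (comp : G → Submodule F A)
    (hcomp : IsGrading comp) :
    IsFine.{u} comp ↔ IsFine.{u} (fun g : G => (comp g).baseChange K) := by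
  constructor
  · intro hfine H _ comp' hcomp' href
    obtain ⟨comp'', hgr, hprop⟩ := exists_isProperRefinement_of_baseChange hcomp hcomp' href
    exact hfine H _ comp'' hgr hprop
  · intro hfine H _ comp' hcomp' href
    exact hfine H _ _ hcomp'.baseChange href.baseChange
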